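/- arXiv:2107.09191 — 3 statements merged into one kernel-verified Lean document; each statement's English description precedes it below -/
import Mathlib

section
/- Let q be an odd prime power and F the finite field with q² elements. Let A be a 2×2 matrix over F, assume the base polynomial F_A is nonsingular, and assume A has an eigenvalue λ ∈ F with a corresponding eigenvector u satisfying ⟨u,u⟩ ≠ 0. Then the numerical range W(A) has exactly (q² + 1)/2 points or exactly (q² − 1)/2 points. -/
open Matrix MvPolynomial

noncomputable section

/-- Conjugate transpose with respect to the Frobenius `x ↦ x ^ q`. -/
def ctrans {F : Type*} [Field F] (q : ℕ) {n : ℕ}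
    (A : Matrix (Fin n) (Fin n) F) : Matrix (Fin n) (Fin n) F :=
  Matrix.of fun i j => (A j i) ^ q

/-- The Hermitian form `⟨u, v⟩ = v* u`. -/
def herm {F : Type*} [Field F] (q : ℕ) {n : ℕ} (u v : Fin n → F) : F :=
  ∑ i, (v i) ^ q * u i

/-- The finite-field numerical range `W(A)`. -/
def numRange {F : Type*} [Field F] (q : ℕ) {n : ℕ}
    (A : Matrix (Fin n) (Fin n) F) : Set F :=
  {z | ∃ v : Fin n → F, herm q v v = 1 ∧ herm q (A.mulVec v) v = z}

/-- `H₁ = (A + A*) / 2`, the Hermitian part of `A`. -/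
def Hone {F : Type*} [Field F] (q : ℕ) {n : ℕ}
    (A : Matrix (Fin n) (Fin n) F) : Matrix (Fin n) (Fin n) F :=
  (2 : F)⁻¹ • (A + ctrans q A)

/-- `H₂ = (A - A*) / (2 β)`. -/
def Htwo {F : Type*} [Field F] (q : ℕ) (β : F) {n : ℕ}
    (A : Matrix (Fin n) (Fin n) F) : Matrix (Fin n) (Fin n) F :=
  (2 * β)⁻¹ • (A - ctrans q A)

/-- The base polynomial `F_A(x, y, t) = det (x H₁ + y H₂ + t I)`,
as a polynomial in the three variables `X 0 = x`, `X 1 = y`, `X 2 = t`. -/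
def basePoly {F : Type*} [Field F] (q : ℕ) (β : F) {n : ℕ} [DecidableEq (Fin n)]
    (A : Matrix (Fin n) (Fin n) F) : MvPolynomial (Fin 3) F :=
  Matrix.det (Matrix.of fun i j =>
    X 0 * C (Hone q A i j) + X 1 * C (Htwo q β A i j) +
      X 2 * C ((1 : Matrix (Fin n) (Fin n) F) i j))

/-- The gradient `∇F_A = (∂F_A/∂x, ∂F_A/∂y, ∂F_A/∂t)` evaluated at a point `p ∈ F³`. -/
def gradBP {F : Type*} [Field F] (q : ℕ) (β : F) {n : ℕ} [DecidableEq (Fin n)]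
    (A : Matrix (Fin n) (Fin n) F) (p : Fin 3 → F) : Fin 3 → F :=
  fun i => eval p (pderiv i (basePoly q β A))

/-- `F_A` is nonsingular at a point `p`. -/
def NonsingAt {F : Type*} [Field F] (q : ℕ) (β : F) {n : ℕ} [DecidableEq (Fin n)]
    (A : Matrix (Fin n) (Fin n) F) (p : Fin 3 → F) : Prop :=
  ¬ (eval p (basePoly q β A) = 0 ∧ gradBP q β A p = 0)

/-- `F_A` is nonsingular (at every nonzero point of `F³`). -/
def Nonsing {F : Type*} [Field F] (q : ℕ) (β : F) {n : ℕ} [DecidableEq (Fin n)]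
    (A : Matrix (Fin n) (Fin n) F) : Prop :=
  ∀ p : Fin 3 → F, p ≠ 0 → NonsingAt q β A p

/-- The (affine) boundary generating curve `Γ_A^∧`:  points `x₀ + β y₀` with
`x₀, y₀ ∈ 𝔽_q` such that the line `x₀ x + y₀ y + t = 0` is tangent to the base curve,
i.e. `∇F_A(p) = c • (x₀, y₀, 1)` for some point `p` of the base curve and `c ≠ 0`. -/
def bgCurve {F : Type*} [Field F] (q : ℕ) (β : F) {n : ℕ} [DecidableEq (Fin n)]
    (A : Matrix (Fin n) (Fin n) F) : Set F :=
  {z | ∃ x₀ y₀ : F, x₀ ^ q = x₀ ∧ y₀ ^ q = y₀ ∧ z = x₀ + β * y₀ ∧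
    ∃ p : Fin 3 → F, p ≠ 0 ∧ ∃ c : F, c ≠ 0 ∧
      eval p (basePoly q β A) = 0 ∧ gradBP q β A p = c • ![x₀, y₀, (1 : F)]}

/-- The preimage `S_z` of `z` under the numerical range map. -/
def preim {F : Type*} [Field F] (q : ℕ) {n : ℕ}
    (A : Matrix (Fin n) (Fin n) F) (z : F) : Set (Fin n → F) :=
  {v | herm q v v = 1 ∧ herm q (A.mulVec v) v = z}

end

open Finset in
/-- In a finite field, a nonzero element killed by the complementary exponent has exactly `n`
roots of order `n`. -/
theorem card_filter_pow_eq {F : Type*} [Field F] [Fintype F] [DecidableEq F] {n m : ℕ}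
    (hnm : n * m + 1 = Fintype.card F) {c : F} (hc : c ^ m = 1) :
    #{z : F | z ^ n = c} = n := by
  have hF : 1 < Fintype.card F := Fintype.one_lt_card
  have hn : 0 < n := Nat.pos_of_ne_zero (by rintro rfl; omega)
  have hm : 0 < m := Nat.pos_of_ne_zero (by rintro rfl; omega)
  have hc0 : c ≠ 0 := by
    rintro rfl
    rw [zero_pow hm.ne'] at hc
    exact zero_ne_one hc
  obtain ⟨g, hg⟩ := IsCyclic.exists_generator (α := Fˣ)
  have hord : orderOf g = n * m := by
    rw [orderOf_eq_card_of_forall_mem_zpowers hg, Nat.card_eq_fintype_card, Fintype.card_units]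
    omega
  have hprim : IsPrimitiveRoot (g : F) (n * m) :=
    IsPrimitiveRoot.coe_units_iff.2 (hord ▸ IsPrimitiveRoot.orderOf g)
  have : NeZero (n * m) := ⟨(Nat.mul_pos hn hm).ne'⟩
  have hζ : IsPrimitiveRoot ((g : F) ^ m) n :=
    hprim.pow (Nat.mul_pos hn hm) (Nat.mul_comm n m)
  obtain ⟨j, hj⟩ := hprim.eq_pow_of_pow_eq_one
    (ξ := c) (by rw [mul_comm, pow_mul, hc, one_pow])
  have hdvd : n ∣ j := by
    have : (g : F) ^ (j * m) = 1 := by rw [pow_mul, hj.2, hc]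
    exact Nat.dvd_of_mul_dvd_mul_right hm (hprim.dvd_of_pow_eq_one _ this)
  obtain ⟨i, rfl⟩ := hdvd
  have hcard := hζ.card_nthRoots c
  rw [if_pos ⟨(g : F) ^ i, by rw [← pow_mul, mul_comm, hj.2]⟩] at hcard
  have hset : ({z : F | z ^ n = c} : Finset F) = (Polynomial.nthRoots n c).toFinset := by
    ext z
    simp [Polynomial.mem_nthRoots hn]
  rw [hset, Multiset.toFinset_card_of_nodup (hζ.nthRoots_nodup hc0), hcard]

section FrobeniusConj

open Finset

variable {F : Type*} [Field F] [Fintype F] {q : ℕ} {σ : F →+* F}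

theorem frobenius_frobenius (hcard : Fintype.card F = q ^ 2) (hσ : ∀ x, σ x = x ^ q) (x : F) :
    σ (σ x) = x := by
  rw [hσ, hσ, ← pow_mul, ← sq, ← hcard, FiniteField.pow_card]

variable [DecidableEq F]

theorem card_norm_fiber (hcard : Fintype.card F = q ^ 2) (hσ : ∀ x, σ x = x ^ q)
    {c : F} (hc0 : c ≠ 0) (hc : σ c = c) : #{z : F | σ z * z = c} = q + 1 := by
  have hF : 1 < Fintype.card F := Fintype.one_lt_card
  obtain ⟨r, rfl⟩ : ∃ r, q = r + 1 := Nat.exists_eq_succ_of_ne_zero (by rintro rfl; simp_all)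
  rw [hσ, pow_succ] at hc
  have h := card_filter_pow_eq (F := F) (n := r + 1 + 1) (m := r) (by rw [hcard]; ring)
    (mul_right_cancel₀ hc0 (hc.trans (one_mul c).symm))
  simpa only [hσ, ← pow_succ] using h

theorem exists_frobeniusNorm_eq (hcard : Fintype.card F = q ^ 2) (hσ : ∀ x, σ x = x ^ q)
    {c : F} (hc0 : c ≠ 0) (hc : σ c = c) : ∃ z, σ z * z = c := by
  have h : 0 < #{z : F | σ z * z = c} := by rw [card_norm_fiber hcard hσ hc0 hc]; omega
  obtain ⟨z, hz⟩ := card_pos.1 h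
  exact ⟨z, (mem_filter.1 hz).2⟩

theorem card_units_fixed (hcard : Fintype.card F = q ^ 2) (hσ : ∀ x, σ x = x ^ q) :
    #{x : F | x ≠ 0 ∧ σ x = x} = q - 1 := by
  have hF : 1 < Fintype.card F := Fintype.one_lt_card
  obtain ⟨r, rfl⟩ : ∃ r, q = r + 1 := Nat.exists_eq_succ_of_ne_zero (by rintro rfl; simp_all)
  have hr : r ≠ 0 := by rintro rfl; simp_all
  have h := card_filter_pow_eq (F := F) (n := r) (m := r + 2) (by rw [hcard]; ring)
    (one_pow _)
  rw [Nat.add_sub_cancel, ← h]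
  congr 1
  ext x
  simp only [mem_filter, mem_univ, true_and, hσ, pow_succ]
  constructor
  · rintro ⟨h0, h1⟩
    exact mul_right_cancel₀ h0 (h1.trans (one_mul x).symm)
  · intro h1
    refine ⟨?_, by rw [h1, one_mul]⟩
    rintro rfl
    rw [zero_pow hr] at h1
    exact zero_ne_one h1

theorem card_fixed (hcard : Fintype.card F = q ^ 2) (hσ : ∀ x, σ x = x ^ q) :
    #{x : F | σ x = x} = q := by
  have hF : 1 < Fintype.card F := Fintype.one_lt_card
  have hq : q ≠ 0 := by rintro rfl; simp_all
  have h0 : (0 : F) ∉ ({x : F | x ≠ 0 ∧ σ x = x} : Finset F) := by simp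
  have h : ({x : F | σ x = x} : Finset F) = insert 0 ({x : F | x ≠ 0 ∧ σ x = x} : Finset F) := by
    ext x
    by_cases hx : x = 0 <;> simp [hx]
  rw [h, card_insert_of_notMem h0, card_units_fixed hcard hσ]
  omega

/-- The pairs `(s, z)` with `s ∈ 𝔽_q` and `N(z) = s(1 - s)`, which parametrize the unit sphere of
`F²` up to scalars of norm one. -/
def sphereParam (σ : F →+* F) : Finset (F × F) :=
  {w | σ w.1 = w.1 ∧ σ w.2 * w.2 = w.1 * (1 - w.1)}

theorem card_sphereParam (hcard : Fintype.card F = q ^ 2) (hσ : ∀ x, σ x = x ^ q) :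
    #(sphereParam σ) = q ^ 2 - q := by
  have hF : 1 < Fintype.card F := Fintype.one_lt_card
  have hmaps : Set.MapsTo Prod.fst (sphereParam σ : Set (F × F))
      (({x : F | σ x = x} : Finset F) : Set F) := by
    intro w hw
    simp only [sphereParam, coe_filter, mem_univ, true_and, Set.mem_ofPred_eq] at hw ⊢
    exact hw.1
  rw [card_eq_sum_card_fiberwise hmaps]
  have hfib : ∀ s ∈ ({x : F | σ x = x} : Finset F),
      #{w ∈ sphereParam σ | w.1 = s} = #{z : F | σ z * z = s * (1 - s)} := by
    intro s hs
    simp only [mem_filter, mem_univ, true_and] at hs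
    refine card_nbij' Prod.snd (fun z => (s, z)) ?_ ?_ ?_ ?_
    · rintro ⟨a, z⟩ h
      simp only [sphereParam, mem_coe, mem_filter, mem_univ, true_and] at h ⊢
      obtain ⟨⟨-, h⟩, rfl⟩ := h
      exact h
    · intro z h
      simp only [sphereParam, mem_coe, mem_filter, mem_univ, true_and] at h ⊢
      exact ⟨⟨hs, h⟩, trivial⟩
    · rintro ⟨a, z⟩ h
      simp only [sphereParam, mem_coe, mem_filter, mem_univ, true_and] at h
      rw [← h.2]
    · intro z h
      rfl
  have hval : ∀ s ∈ ({x : F | σ x = x} : Finset F),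
      #{z : F | σ z * z = s * (1 - s)} + (if s = 0 then q else 0) + (if s = 1 then q else 0)
        = q + 1 := by
    intro s hs
    simp only [mem_filter, mem_univ, true_and] at hs
    by_cases h0 : s = 0
    · simp [h0, add_comm, filter_eq']
    by_cases h1 : s = 1
    · simp [h1, add_comm, filter_eq']
    rw [card_norm_fiber hcard hσ (mul_ne_zero h0 (sub_ne_zero.2 (Ne.symm h1)))
      (by simp [hs]), if_neg h0, if_neg h1]
  have hsum := sum_congr rfl hval
  rw [sum_add_distrib, sum_add_distrib, sum_const, card_fixed hcard hσ] at hsum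
  simp only [sum_ite_eq', mem_filter, mem_univ, map_zero, map_one, if_true, true_and,
    smul_eq_mul] at hsum
  rw [sum_congr rfl hfib, sq]
  have : q * (q + 1) = q * q + q := by ring
  omega

/-- The discriminant, up to squares, of the equation cutting out the fibre over `ζ` of
`(s, z) ↦ ε s + z` on `sphereParam σ`. -/
def fibreDisc (σ : F →+* F) (ε ζ : F) : F :=
  (ζ * σ ε + σ ζ * ε + 1) ^ 2 - 4 * (1 + ε * σ ε) * (ζ * σ ζ)

theorem card_image_sphereParam (h2 : (2 : F) ≠ 0) (hσσ : ∀ x, σ (σ x) = x) {ε : F}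
    (hε : 1 + ε * σ ε ≠ 0) :
    #(sphereParam σ) + #{ζ : F | fibreDisc σ ε ζ = 0} =
      2 * #((sphereParam σ).image fun w => ε * w.1 + w.2) := by
  set V := (sphereParam σ).image fun w => ε * w.1 + w.2
  have hroot : ∀ ζ s : F, σ s = s → ((s, ζ - ε * s) ∈ sphereParam σ ↔
      (1 + ε * σ ε) * s ^ 2 - (ζ * σ ε + σ ζ * ε + 1) * s + ζ * σ ζ = 0) := by
    intro ζ s hs
    simp only [sphereParam, mem_filter, mem_univ, true_and, hs, map_sub, map_mul]
    constructor
    · intro h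
      linear_combination h
    · intro h
      linear_combination h
  have hcoef : ∀ ζ, σ ((ζ * σ ε + σ ζ * ε + 1) / (1 + ε * σ ε)) =
      (ζ * σ ε + σ ζ * ε + 1) / (1 + ε * σ ε) := by
    intro ζ
    simp only [map_div₀, map_add, map_mul, map_one, hσσ]
    congr 1 <;> ring
  have hfib : ∀ ζ ∈ V, #{w ∈ sphereParam σ | ε * w.1 + w.2 = ζ} +
      (if fibreDisc σ ε ζ = 0 then 1 else 0) = 2 := by
    intro ζ hζ
    obtain ⟨⟨s, z⟩, hw, hsz⟩ := mem_image.1 hζ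
    dsimp only at hsz
    obtain rfl : z = ζ - ε * s := by rw [← hsz]; ring
    have hs : σ s = s := (mem_filter.1 hw).2.1
    have hr := (hroot ζ s hs).1 hw
    obtain ⟨s', hs_conj⟩ : ∃ s', s' = (ζ * σ ε + σ ζ * ε + 1) / (1 + ε * σ ε) - s := ⟨_, rfl⟩
    have hs' : σ s' = s' := by rw [hs_conj, map_sub, hcoef, hs]
    have hT : (1 + ε * σ ε) * (s + s') = ζ * σ ε + σ ζ * ε + 1 := by
      rw [hs_conj]; field_simp; ring
    have hr' : (1 + ε * σ ε) * s' ^ 2 - (ζ * σ ε + σ ζ * ε + 1) * s' + ζ * σ ζ = 0 := by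
      linear_combination hr + (s' - s) * hT
    have hset : ({w ∈ sphereParam σ | ε * w.1 + w.2 = ζ} : Finset (F × F)) =
        {(s, ζ - ε * s), (s', ζ - ε * s')} := by
      ext ⟨a, z⟩
      simp only [mem_filter, mem_insert, mem_singleton, Prod.mk.injEq]
      constructor
      · rintro ⟨ha, haz⟩
        obtain rfl : z = ζ - ε * a := by rw [← haz]; ring
        have hra := (hroot ζ a (mem_filter.1 ha).2.1).1 ha
        have hprod : (1 + ε * σ ε) * ((a - s) * (a - s')) = 0 := by
          linear_combination hra - hr + (s - a) * hT
        rcases mul_eq_zero.1 ((mul_eq_zero.1 hprod).resolve_left hε) with h | h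
        · left; rw [sub_eq_zero.1 h]; exact ⟨rfl, rfl⟩
        · right; rw [sub_eq_zero.1 h]; exact ⟨rfl, rfl⟩
      · rintro (⟨rfl, rfl⟩ | ⟨rfl, rfl⟩)
        · exact ⟨hw, by ring⟩
        · exact ⟨(hroot ζ _ hs').2 hr', by ring⟩
    have hdisc : fibreDisc σ ε ζ = ((1 + ε * σ ε) * (s - s')) ^ 2 := by
      rw [fibreDisc]
      linear_combination (-4 * (1 + ε * σ ε)) * hr
        - (ζ * σ ε + σ ζ * ε + 1 + (1 + ε * σ ε) * (s + s') - 4 * (1 + ε * σ ε) * s) * hT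
    have hiff : fibreDisc σ ε ζ = 0 ↔ s = s' := by
      rw [hdisc, sq_eq_zero_iff, mul_eq_zero, or_iff_right hε, sub_eq_zero]
    by_cases hss : s = s'
    · rw [if_pos (hiff.2 hss), hset, ← hss, pair_eq_singleton, card_singleton]
    · rw [if_neg (mt hiff.1 hss), hset, card_pair]
      intro h
      exact hss (Prod.mk.inj h).1
  have hsub : ({ζ : F | fibreDisc σ ε ζ = 0} : Finset F) = {ζ ∈ V | fibreDisc σ ε ζ = 0} := by
    ext ζ
    simp only [mem_filter, mem_univ, true_and, iff_and_self]
    intro hD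
    set s := (ζ * σ ε + σ ζ * ε + 1) / (1 + ε * σ ε) / 2 with hsdef
    have hs : σ s = s := by rw [hsdef, map_div₀, hcoef, map_ofNat]
    have hT : 2 * (1 + ε * σ ε) * s = ζ * σ ε + σ ζ * ε + 1 := by
      rw [hsdef]; field_simp
    refine mem_image.2 ⟨(s, ζ - ε * s), (hroot ζ s hs).2 ?_, by ring⟩
    rw [fibreDisc] at hD
    have h4 : (4 * (1 + ε * σ ε)) ≠ 0 :=
      mul_ne_zero (by rw [show (4 : F) = 2 * 2 by norm_num]; exact mul_ne_zero h2 h2) hε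
    refine (mul_eq_zero.1 (?_ : (4 * (1 + ε * σ ε)) * _ = 0)).resolve_left h4
    linear_combination -hD + (2 * (1 + ε * σ ε) * s - (ζ * σ ε + σ ζ * ε + 1)) * hT
  have hsum := sum_congr rfl hfib
  rw [sum_add_distrib, ← card_eq_sum_card_fiberwise, ← card_filter, ← hsub, sum_const,
    smul_eq_mul, mul_comm] at hsum
  · exact hsum
  · intro w hw
    exact mem_coe.2 (mem_image_of_mem _ hw)

theorem card_fibreDisc_eq_zero (hcard : Fintype.card F = q ^ 2) (hodd : Odd q)
    (h2 : (2 : F) ≠ 0) (hσ : ∀ x, σ x = x ^ q) {ε : F} (hε : 1 + ε * σ ε ≠ 0) :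
    #{ζ : F | fibreDisc σ ε ζ = 0} = q + 1 ∨ #{ζ : F | fibreDisc σ ε ζ = 0} = q - 1 := by
  have hσσ := frobenius_frobenius hcard hσ
  have h4 : (4 : F) ≠ 0 := by rw [show (4 : F) = 2 * 2 by norm_num]; exact mul_ne_zero h2 h2
  by_cases hε0 : ε = 0
  · left
    rw [← card_norm_fiber hcard hσ (inv_ne_zero h4) (by rw [map_inv₀, map_ofNat])]
    congr 1
    ext ζ
    simp only [fibreDisc, hε0, mem_filter, mem_univ, true_and, map_zero]
    rw [← mul_eq_one_iff_eq_inv₀ h4]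
    constructor <;> intro h <;> linear_combination -h
  have hσε0 : σ ε ≠ 0 := (map_ne_zero σ).2 hε0
  set e := ε * σ ε with he
  have hσe : σ e = e := by rw [he, map_mul, hσσ, mul_comm]
  have he0 : e ≠ 0 := mul_ne_zero hε0 hσε0
  have hσ1e : σ (1 + e) = 1 + e := by rw [map_add, map_one, hσe]
  obtain ⟨k, hk⟩ : ∃ k : F, k ^ 2 = 1 + e := by
    obtain ⟨z, hz⟩ := exists_frobeniusNorm_eq hcard hσ hε hσ1e
    obtain ⟨r, hr⟩ := hodd
    refine ⟨z ^ (r + 1), ?_⟩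
    rw [← hz, hσ, ← pow_succ, ← pow_mul, hr]
    congr 1
    ring
  have hk0 : k ≠ 0 := by
    rintro rfl
    exact hε (by rw [← hk]; ring)
  have hσk : σ k = k ∨ σ k = -k := by
    rw [← sq_eq_sq_iff_eq_or_eq_neg, ← map_pow, hk, hσ1e]
  have hD : ∀ ζ, fibreDisc σ ε ζ = 0 ↔
      (ζ * σ ε + σ ζ * ε - e + k * (ζ * σ ε - σ ζ * ε)) *
        (ζ * σ ε + σ ζ * ε - e - k * (ζ * σ ε - σ ζ * ε)) = e * (1 + e) := by
    intro ζ
    rw [fibreDisc, ← he]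
    constructor
    · intro h
      linear_combination -e * h - (ζ * σ ε - σ ζ * ε) ^ 2 * hk + 4 * (1 + e) * ζ * σ ζ * he
    · intro h
      refine (mul_eq_zero.1 (?_ : e * _ = 0)).resolve_left he0
      linear_combination -h - (ζ * σ ε - σ ζ * ε) ^ 2 * hk + 4 * (1 + e) * ζ * σ ζ * he
  rcases hσk with hσk | hσk
  · left
    rw [← card_norm_fiber hcard hσ (mul_ne_zero he0 hε) (by rw [map_mul, hσe, hσ1e])]
    refine card_nbij' (fun ζ => ζ * σ ε + σ ζ * ε - e + k * (ζ * σ ε - σ ζ * ε))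
      (fun w => ((w + σ w) / 2 + e + (w - σ w) / (2 * k)) / 2 / σ ε) ?_ ?_ ?_ ?_
    · intro ζ hζ
      simp only [mem_coe, mem_filter, mem_univ, true_and, hD] at hζ ⊢
      rw [← hζ]
      simp only [map_add, map_sub, map_mul, hσσ, hσe, hσk]
      ring
    · intro w hw
      simp only [mem_coe, mem_filter, mem_univ, true_and, hD] at hw ⊢
      simp only [map_add, map_sub, map_mul, map_div₀, map_ofNat, hσσ, hσe, hσk]
      rw [← hw]
      field_simp
      ring
    · intro ζ hζ
      simp only [map_add, map_sub, map_mul, hσσ, hσe, hσk]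
      field_simp
      ring
    · intro w hw
      simp only [map_add, map_sub, map_mul, map_div₀, map_ofNat, hσσ, hσe, hσk]
      field_simp
      ring
  · right
    rw [← card_units_fixed hcard hσ]
    have hm0 : e * (1 + e) ≠ 0 := mul_ne_zero he0 hε
    refine card_nbij' (fun ζ => ζ * σ ε + σ ζ * ε - e + k * (ζ * σ ε - σ ζ * ε))
      (fun w => ((w + e * (1 + e) / w) / 2 + e + (w - e * (1 + e) / w) / (2 * k)) / 2 / σ ε)
      ?_ ?_ ?_ ?_
    · intro ζ hζ
      simp only [mem_coe, mem_filter, mem_univ, true_and, hD] at hζ ⊢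
      refine ⟨left_ne_zero_of_mul (hζ ▸ hm0), ?_⟩
      simp only [map_add, map_sub, map_mul, hσσ, hσe, hσk]
      ring
    · intro w hw
      simp only [mem_coe, mem_filter, mem_univ, true_and, hD] at hw ⊢
      obtain ⟨hw0, hw⟩ := hw
      simp only [map_add, map_sub, map_mul, map_div₀, map_ofNat, map_one, hσσ, hσe, hσk, hw]
      field_simp
      ring
    · intro ζ hζ
      simp only [mem_coe, mem_filter, mem_univ, true_and, hD] at hζ
      dsimp only
      rw [← hζ, mul_div_cancel_left₀ _ (left_ne_zero_of_mul (hζ ▸ hm0))]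
      field_simp
      ring
    · intro w hw
      simp only [mem_coe, mem_filter, mem_univ, true_and] at hw
      obtain ⟨hw0, hw⟩ := hw
      simp only [map_add, map_sub, map_mul, map_div₀, map_ofNat, map_one, hσσ, hσe, hσk, hw]
      field_simp
      ring

end FrobeniusConj

section UnitaryInvariance

variable {F : Type*} [Field F] {q : ℕ} {σ : F →+* F} {n : ℕ}

theorem ctrans_eq (hσ : ∀ x, σ x = x ^ q) (A : Matrix (Fin n) (Fin n) F) :
    ctrans q A = (A.map σ)ᵀ := by
  ext i j
  simp [ctrans, hσ]

theorem ctrans_ctrans (hσ : ∀ x, σ x = x ^ q) (hσσ : ∀ x, σ (σ x) = x)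
    (A : Matrix (Fin n) (Fin n) F) : ctrans q (ctrans q A) = A := by
  ext i j
  simp [ctrans_eq hσ, hσσ]

theorem ctrans_mul (hσ : ∀ x, σ x = x ^ q) (A B : Matrix (Fin n) (Fin n) F) :
    ctrans q (A * B) = ctrans q B * ctrans q A := by
  rw [ctrans_eq hσ, ctrans_eq hσ, ctrans_eq hσ, Matrix.map_mul, Matrix.transpose_mul]

theorem herm_mulVec_left (hσ : ∀ x, σ x = x ^ q) (hσσ : ∀ x, σ (σ x) = x)
    (M : Matrix (Fin n) (Fin n) F) (u v : Fin n → F) :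
    herm q (M *ᵥ u) v = herm q u (ctrans q M *ᵥ v) := by
  simp only [herm, ctrans_eq hσ, ← hσ, mulVec, dotProduct, map_sum, map_mul, transpose_apply,
    map_apply, hσσ, Finset.mul_sum, Finset.sum_mul]
  rw [Finset.sum_comm]
  exact Finset.sum_congr rfl fun _ _ => Finset.sum_congr rfl fun _ _ => by ring

theorem numRange_unitary_conj_subset (hσ : ∀ x, σ x = x ^ q) (hσσ : ∀ x, σ (σ x) = x)
    {U : Matrix (Fin n) (Fin n) F} (hU : U * ctrans q U = 1) (T : Matrix (Fin n) (Fin n) F) :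
    numRange q (U * T * ctrans q U) ⊆ numRange q T := by
  rintro z ⟨v, hv, rfl⟩
  refine ⟨ctrans q U *ᵥ v, ?_, ?_⟩
  · rw [herm_mulVec_left hσ hσσ, ctrans_ctrans hσ hσσ, mulVec_mulVec, hU, one_mulVec, hv]
  · rw [← herm_mulVec_left hσ hσσ, mulVec_mulVec, mulVec_mulVec, mul_assoc]

theorem numRange_unitary_conj (hσ : ∀ x, σ x = x ^ q) (hσσ : ∀ x, σ (σ x) = x)
    {U : Matrix (Fin n) (Fin n) F} (hU : U * ctrans q U = 1) (T : Matrix (Fin n) (Fin n) F) :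
    numRange q (U * T * ctrans q U) = numRange q T := by
  refine (numRange_unitary_conj_subset hσ hσσ hU T).antisymm ?_
  have hU' : ctrans q U * U = 1 := mul_eq_one_comm.1 hU
  have h := numRange_unitary_conj_subset hσ hσσ (U := ctrans q U)
    (by rw [ctrans_ctrans hσ hσσ, hU']) (U * T * ctrans q U)
  rwa [ctrans_ctrans hσ hσσ, show ctrans q U * (U * T * ctrans q U) * U =
    (ctrans q U * U) * T * (ctrans q U * U) by simp only [mul_assoc], hU', one_mul,
    mul_one] at h

theorem ctrans_unitary_conj (hσ : ∀ x, σ x = x ^ q) (hσσ : ∀ x, σ (σ x) = x)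
    (U T : Matrix (Fin n) (Fin n) F) :
    ctrans q (U * T * ctrans q U) = U * ctrans q T * ctrans q U := by
  rw [ctrans_mul hσ, ctrans_mul hσ, ctrans_ctrans hσ hσσ, mul_assoc]

theorem basePoly_unitary_conj (hσ : ∀ x, σ x = x ^ q) (hσσ : ∀ x, σ (σ x) = x) (β : F)
    {U : Matrix (Fin n) (Fin n) F} (hU : U * ctrans q U = 1) (T : Matrix (Fin n) (Fin n) F) :
    basePoly q β (U * T * ctrans q U) = basePoly q β T := by
  have hform : ∀ A : Matrix (Fin n) (Fin n) F, basePoly q β A =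
      det ((X 0 : MvPolynomial (Fin 3) F) • (Hone q A).map C + (X 1 : MvPolynomial (Fin 3) F) •
        (Htwo q β A).map C + (X 2 : MvPolynomial (Fin 3) F) •
          (1 : Matrix (Fin n) (Fin n) (MvPolynomial (Fin 3) F))) := by
    intro A
    rw [basePoly]
    congr 1
    ext1 i j
    simp [Matrix.one_apply, apply_ite C]
  have h1 : Hone q (U * T * ctrans q U) = U * Hone q T * ctrans q U := by
    simp only [Hone, ctrans_unitary_conj hσ hσσ, Matrix.mul_smul, Matrix.smul_mul, mul_add,
      add_mul]
  have h2 : Htwo q β (U * T * ctrans q U) = U * Htwo q β T * ctrans q U := by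
    simp only [Htwo, ctrans_unitary_conj hσ hσσ, Matrix.mul_smul, Matrix.smul_mul, mul_sub,
      sub_mul]
  have hUC : U.map C * (ctrans q U).map C =
      (1 : Matrix (Fin n) (Fin n) (MvPolynomial (Fin 3) F)) := by
    rw [← Matrix.map_mul, hU, Matrix.map_one C (map_zero C) (map_one C)]
  have hconj : ∀ M N : Matrix (Fin n) (Fin n) F,
      (X 0 : MvPolynomial (Fin 3) F) • (U * M * ctrans q U).map C +
        (X 1 : MvPolynomial (Fin 3) F) • (U * N * ctrans q U).map C +
        (X 2 : MvPolynomial (Fin 3) F) •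
          (1 : Matrix (Fin n) (Fin n) (MvPolynomial (Fin 3) F)) =
      U.map C * ((X 0 : MvPolynomial (Fin 3) F) • M.map C +
        (X 1 : MvPolynomial (Fin 3) F) • N.map C +
        (X 2 : MvPolynomial (Fin 3) F) •
          (1 : Matrix (Fin n) (Fin n) (MvPolynomial (Fin 3) F))) * (ctrans q U).map C := by
    intro M N
    simp only [Matrix.map_mul, mul_add, add_mul, Matrix.mul_smul, Matrix.smul_mul, mul_one, hUC]
  rw [hform, hform, h1, h2, hconj, det_mul, det_mul, mul_right_comm, ← det_mul, hUC, det_one,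
    one_mul]

theorem nonsing_unitary_conj (hσ : ∀ x, σ x = x ^ q) (hσσ : ∀ x, σ (σ x) = x) {β : F}
    {U T : Matrix (Fin n) (Fin n) F} (hU : U * ctrans q U = 1)
    (hns : Nonsing q β (U * T * ctrans q U)) : Nonsing q β T := by
  intro p hp
  have h := hns p hp
  unfold NonsingAt gradBP at h ⊢
  rwa [basePoly_unitary_conj hσ hσσ β hU] at h

/-- A matrix over `F` with an anisotropic eigenvector is unitarily upper triangularizable. -/
theorem exists_unitary_triangular [Fintype F] (hcard : Fintype.card F = q ^ 2)
    (hσ : ∀ x, σ x = x ^ q) (A : Matrix (Fin 2) (Fin 2) F)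
    (heig : ∃ (lam : F) (u : Fin 2 → F), u ≠ 0 ∧ A.mulVec u = lam • u ∧ herm q u u ≠ 0) :
    ∃ (U : Matrix (Fin 2) (Fin 2) F) (lam mu b : F), U * ctrans q U = 1 ∧
      A = U * !![lam, b; 0, mu] * ctrans q U := by
  classical
  have hσσ := frobenius_frobenius hcard hσ
  obtain ⟨lam, u, -, hAu, hu⟩ := heig
  have hherm : ∀ v : Fin 2 → F, herm q v v = σ (v 0) * v 0 + σ (v 1) * v 1 := by
    intro v
    simp [herm, hσ, Fin.sum_univ_two]
  obtain ⟨c, hc⟩ : ∃ c, σ c * c = (herm q u u)⁻¹ := by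
    refine exists_frobeniusNorm_eq hcard hσ (inv_ne_zero hu) ?_
    rw [map_inv₀, hherm]
    simp only [map_add, map_mul, hσσ]
    congr 1
    ring
  obtain ⟨a, ha⟩ : ∃ a, a = c * u 0 := ⟨_, rfl⟩
  obtain ⟨d, hd⟩ : ∃ d, d = c * u 1 := ⟨_, rfl⟩
  have hone : σ a * a + σ d * d = 1 := by
    rw [← inv_mul_cancel₀ hu, ← hc, hherm, ha, hd, map_mul, map_mul]
    ring
  have e0 : A 0 0 * a + A 0 1 * d = lam * a := by
    have := congrFun hAu 0
    simp only [mulVec, dotProduct, Fin.sum_univ_two, Pi.smul_apply, smul_eq_mul] at this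
    rw [ha, hd]
    linear_combination c * this
  have e1 : A 1 0 * a + A 1 1 * d = lam * d := by
    have := congrFun hAu 1
    simp only [mulVec, dotProduct, Fin.sum_univ_two, Pi.smul_apply, smul_eq_mul] at this
    rw [ha, hd]
    linear_combination c * this
  set U : Matrix (Fin 2) (Fin 2) F := !![a, -σ d; d, σ a] with hUdef
  have hUs : ctrans q U = !![σ a, σ d; -d, a] := by
    rw [ctrans_eq hσ]
    ext i j
    fin_cases i <;> fin_cases j <;> simp [hUdef, hσσ]
  have hU' : ctrans q U * U = 1 := by
    rw [hUs, hUdef]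
    ext i j
    fin_cases i <;> fin_cases j <;> simp [Matrix.mul_apply, Fin.sum_univ_two]
    · exact hone
    · ring
    · ring
    · linear_combination hone
  have hU : U * ctrans q U = 1 := mul_eq_one_comm.1 hU'
  set T := ctrans q U * A * U with hT
  have hAT : A = U * T * ctrans q U := by
    rw [hT, show U * (ctrans q U * A * U) * ctrans q U =
      (U * ctrans q U) * A * (U * ctrans q U) by simp only [mul_assoc], hU, one_mul, mul_one]
  have hT10 : T 1 0 = 0 := by
    simp only [hT, hUs, Matrix.mul_apply, Fin.sum_univ_two]
    simp [hUdef]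
    linear_combination a * e1 - d * e0
  refine ⟨U, T 0 0, T 1 1, T 0 1, hU, ?_⟩
  rw [← hT10, ← Matrix.eta_fin_two T]
  exact hAT

theorem nonsing_triangular (hσ : ∀ x, σ x = x ^ q) (h2 : (2 : F) ≠ 0)
    {β : F} (hβ0 : β ≠ 0) {lam mu b : F} (hns : Nonsing q β !![lam, b; 0, mu]) :
    b ≠ 0 ∧ b * σ b + (mu - lam) * σ (mu - lam) ≠ 0 := by
  have key : ∀ P l m : F, 2 * P + (mu - lam) * l + σ (mu - lam) * m = 0 →
      (mu - lam) * P = b * σ b * m → σ (mu - lam) * P = b * σ b * l → P = 0 ∧ l = 0 ∧ m = 0 := by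
    intro P l m hP hl hm
    rw [map_sub] at hP hm
    have hnz := hns ![l + m, β * (l - m), P - l * lam - m * σ lam]
    by_contra hne
    refine hnz ?_ ⟨?_, ?_⟩
    · intro h0
      refine hne ?_
      have hx := congrFun h0 0
      have hy := congrFun h0 1
      have ht := congrFun h0 2
      simp only [cons_val_zero, cons_val_one, cons_val, Pi.zero_apply] at hx hy ht
      have hlm := (mul_eq_zero.1 hy).resolve_left hβ0
      have hl0 : l = 0 :=
        (mul_eq_zero.1 (by linear_combination hx + hlm : 2 * l = 0)).resolve_left h2
      have hm0 : m = 0 := by linear_combination hx - hl0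
      exact ⟨by linear_combination ht + lam * hl0 + σ lam * hm0, hl0, hm0⟩
    · simp [basePoly, det_fin_two, Hone, Htwo, ctrans_eq hσ]
      field_simp
      linear_combination 2 * P * hP + 2 * l * hl + 2 * m * hm
    · ext i
      fin_cases i
      · simp [gradBP, basePoly, det_fin_two, Hone, Htwo, ctrans_eq hσ]
        field_simp
        linear_combination 2 * (lam + σ lam) * hP + 2 * hl + 2 * hm
      · simp [gradBP, basePoly, det_fin_two, Hone, Htwo, ctrans_eq hσ]
        field_simp
        linear_combination 2 * (lam - σ lam) * hP + 2 * hl - 2 * hm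
      · simp [gradBP, basePoly, det_fin_two, Hone, Htwo, ctrans_eq hσ]
        field_simp
        linear_combination 2 * hP
  have hb : b ≠ 0 := by
    rintro rfl
    by_cases hd : mu - lam = 0
    · exact one_ne_zero (key 0 1 0 (by simp [hd]) (by simp) (by simp)).2.1
    · refine hd (neg_eq_zero.1 (key 0 (σ (mu - lam)) (-(mu - lam)) ?_ ?_ ?_).2.2) <;> ring
  refine ⟨hb, fun h => ?_⟩
  refine mul_ne_zero hb ((map_ne_zero σ).2 hb)
    (key (b * σ b) (σ (mu - lam)) (mu - lam) ?_ ?_ ?_).1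
  · linear_combination 2 * h
  · ring
  · ring

theorem numRange_triangular [Fintype F] [DecidableEq F] (hcard : Fintype.card F = q ^ 2)
    (hσ : ∀ x, σ x = x ^ q) {lam mu b : F} (hb : b ≠ 0) :
    numRange q !![lam, b; 0, mu] = (fun ζ => lam + b * ζ) ''
      ((sphereParam σ).image fun w => (mu - lam) / b * w.1 + w.2 : Finset F) := by
  have hσσ := frobenius_frobenius hcard hσ
  ext z
  simp only [numRange, Set.mem_ofPred_eq, Set.mem_image, Finset.mem_coe, Finset.mem_image,
    sphereParam, Finset.mem_filter, Finset.mem_univ, true_and, Prod.exists, herm, ← hσ, mulVec,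
    dotProduct, Fin.sum_univ_two, of_apply, cons_val_zero, cons_val_one]
  constructor
  · rintro ⟨v, hv, rfl⟩
    refine ⟨_, ⟨σ (v 1) * v 1, v 1 * σ (v 0), ⟨?_, ?_⟩, rfl⟩, ?_⟩
    · rw [map_mul, hσσ, mul_comm]
    · rw [map_mul, hσσ]
      linear_combination (σ (v 1) * v 1) * hv
    · field_simp
      linear_combination -lam * hv
  · rintro ⟨_, ⟨s, w, ⟨hs, hw⟩, rfl⟩, rfl⟩
    by_cases hs0 : s = 0
    · subst hs0
      rw [zero_mul, mul_eq_zero, map_eq_zero, or_self] at hw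
      subst hw
      exact ⟨![1, 0], by simp, by simp⟩
    · obtain ⟨y, hy⟩ := exists_frobeniusNorm_eq hcard hσ hs0 hs
      have hy0 : y ≠ 0 := right_ne_zero_of_mul (hy.symm ▸ hs0)
      have hσy0 : σ y ≠ 0 := (map_ne_zero σ).2 hy0
      have hx : w / y * σ (w / y) = 1 - s := by
        rw [map_div₀]
        field_simp
        linear_combination hw - (1 - s) * hy
      refine ⟨![σ (w / y), y], ?_, ?_⟩
      · simp only [cons_val_zero, cons_val_one, hσσ]
        linear_combination hx + hy
      · simp only [cons_val_zero, cons_val_one, hσσ]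
        rw [mul_add, mul_left_comm, hx]
        field_simp
        linear_combination mu * hy

end UnitaryInvariance

/-- The `q`-power map on a field with `q²` elements, `q` a prime power, is a ring homomorphism. -/
theorem exists_frobenius {F : Type*} [Field F] [Fintype F] {p k q : ℕ} (hp : p.Prime)
    (hq : q = p ^ k) (hcard : Fintype.card F = q ^ 2) : ∃ σ : F →+* F, ∀ x, σ x = x ^ q := by
  subst hq
  have : Fact p.Prime := ⟨hp⟩
  have : CharP F p := charP_of_card_eq_prime_pow (f := k * 2) (by
    rw [hcard, pow_mul])
  exact ⟨iterateFrobenius F p k, fun x => iterateFrobenius_def p k x⟩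

theorem stmt_2 {F : Type*} [Field F] [Fintype F] (q : ℕ)
    (hq : ∃ p k : ℕ, p.Prime ∧ Odd p ∧ 0 < k ∧ q = p ^ k)
    (hcard : Fintype.card F = q ^ 2)
    (β : F) (hβ0 : β ≠ 0) (hβ : β ^ q = -β)
    (A : Matrix (Fin 2) (Fin 2) F) (hns : Nonsing q β A)
    (heig : ∃ (lam : F) (u : Fin 2 → F), u ≠ 0 ∧ A.mulVec u = lam • u ∧ herm q u u ≠ 0) :
    (numRange q A).ncard = (q ^ 2 + 1) / 2 ∨ (numRange q A).ncard = (q ^ 2 - 1) / 2 := by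
  classical
  obtain ⟨p, k, hp, hodd, -, hq⟩ := hq
  obtain ⟨σ, hσ⟩ := exists_frobenius hp hq hcard
  have hqodd : Odd q := hq ▸ hodd.pow
  have h2 : (2 : F) ≠ 0 := by
    refine Ring.two_ne_zero fun h => ?_
    have := FiniteField.even_card_of_char_two h
    rw [hcard] at this
    exact Nat.not_even_iff_odd.2 hqodd.pow (Nat.even_iff.2 this)
  have hσσ := frobenius_frobenius hcard hσ
  obtain ⟨U, lam, mu, b, hU, rfl⟩ := exists_unitary_triangular hcard hσ A heig
  obtain ⟨hb, hN⟩ := nonsing_triangular hσ h2 hβ0 (nonsing_unitary_conj hσ hσσ hU hns)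
  have hσb : σ b ≠ 0 := (map_ne_zero σ).2 hb
  have hε : 1 + (mu - lam) / b * σ ((mu - lam) / b) ≠ 0 := by
    rw [map_div₀]
    intro h
    field_simp at h
    exact hN (by linear_combination h)
  have hinj : Function.Injective fun ζ : F => lam + b * ζ := fun x y h =>
    mul_left_cancel₀ hb (add_left_cancel h)
  rw [numRange_unitary_conj hσ hσσ hU, numRange_triangular hcard hσ hb,
    Set.ncard_image_of_injective _ hinj, Set.ncard_coe_finset]
  have h1 := card_image_sphereParam h2 hσσ hε
  rw [card_sphereParam hcard hσ] at h1
  have hq1 : 1 ≤ q := hqodd.pos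
  have hle : q ≤ q ^ 2 := Nat.le_self_pow two_ne_zero q
  rcases card_fibreDisc_eq_zero hcard hqodd h2 hσ hε with h | h
  · left; omega
  · right; omega
end

section
/- Schur's theorem over finite fields: Let q be an odd prime power, F the finite field with q² elements, and A a 2×2 matrix over F. Assume A has an eigenvalue λ ∈ F with some eigenvector v satisfying ⟨v,v⟩ ≠ 0. Then there exists a unitary matrix U ∈ M₂(F) (i.e., U*U = I) such that U*AU is upper triangular (its (2,1) entry is 0). -/
open Matrix MvPolynomial

/-- In a field with `q ^ 2` elements, every nonzero element fixed by `x ↦ x ^ q` is a norm. -/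
theorem exists_pow_succ_eq_of_pow_eq_self {F : Type*} [Field F] [Fintype F] {q : ℕ} (hq : 1 < q)
    (hcard : Fintype.card F = q ^ 2) {c : F} (hc0 : c ≠ 0) (hc : c ^ q = c) :
    ∃ s : F, s ^ (q + 1) = c := by
  obtain ⟨g, hg⟩ := IsCyclic.exists_monoid_generator (α := Fˣ)
  have hord : orderOf g = (q - 1) * (q + 1) := by
    rw [orderOf_eq_card_of_forall_mem_powers hg, Nat.card_units, Nat.card_eq_fintype_card, hcard,
      mul_comm, ← Nat.sq_sub_sq, one_pow]
  obtain ⟨m, hm : g ^ m = Units.mk0 c hc0⟩ := hg (Units.mk0 c hc0)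
  have hone : Units.mk0 c hc0 ^ (q - 1) = 1 := by
    ext
    have h : c ^ (q - 1) * c = 1 * c := by rw [pow_sub_one_mul (by lia), hc, one_mul]
    simpa using mul_right_cancel₀ hc0 h
  rw [← hm, ← pow_mul, ← orderOf_dvd_iff_pow_eq_one, hord, mul_comm m] at hone
  obtain ⟨k, rfl⟩ := Nat.dvd_of_mul_dvd_mul_left (by lia) hone
  refine ⟨((g ^ k : Fˣ) : F), ?_⟩
  have h := congrArg Units.val hm
  rw [mul_comm, pow_mul] at h
  simpa using h

theorem stmt_8 {F : Type*} [Field F] [Fintype F] (q : ℕ)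
    (hq : ∃ p k : ℕ, p.Prime ∧ Odd p ∧ 0 < k ∧ q = p ^ k)
    (hcard : Fintype.card F = q ^ 2)
    (β : F) (hβ0 : β ≠ 0) (hβ : β ^ q = -β)
    (A : Matrix (Fin 2) (Fin 2) F)
    (heig : ∃ (lam : F) (v : Fin 2 → F), v ≠ 0 ∧ A.mulVec v = lam • v ∧ herm q v v ≠ 0) :
    ∃ U : Matrix (Fin 2) (Fin 2) F, ctrans q U * U = 1 ∧ (ctrans q U * A * U) 1 0 = 0 := by
  obtain ⟨p, k, hp, hodd, hk, hqk⟩ := hq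
  have : Fact p.Prime := ⟨hp⟩
  have : CharP F p := charP_of_card_eq_prime_pow (f := k * 2) (by
    rw [hcard, hqk, pow_mul])
  have hqodd : Odd q := hqk ▸ hodd.pow
  have hq1 : 1 < q := hqk ▸ Nat.one_lt_pow hk.ne' hp.one_lt
  have hadd (x y : F) : (x + y) ^ q = x ^ q + y ^ q := by
    rw [hqk]; exact add_pow_char_pow x y p k
  have hconj (x : F) : (x ^ q) ^ q = x := by
    rw [← pow_mul, ← sq, ← hcard, FiniteField.pow_card]
  obtain ⟨lam, v, -, hv, hvv⟩ := heig
  have hfix : (herm q v v)⁻¹ ^ q = (herm q v v)⁻¹ := by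
    rw [inv_pow]
    simp only [herm, Fin.sum_univ_two, hadd, mul_pow, hconj]
    ring
  obtain ⟨s, hs⟩ := exists_pow_succ_eq_of_pow_eq_self hq1 hcard (inv_ne_zero hvv) hfix
  obtain ⟨w, hw⟩ : ∃ w, w = s • v := ⟨_, rfl⟩
  have hAw : A.mulVec w = lam • w := by
    rw [hw, mulVec_smul, hv, smul_comm]
  have hww : w 0 ^ q * w 0 + w 1 ^ q * w 1 = 1 := by
    have h : s ^ (q + 1) * herm q v v = 1 := by rw [hs, inv_mul_cancel₀ hvv]
    simp only [herm, Fin.sum_univ_two] at h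
    simp only [hw, Pi.smul_apply, smul_eq_mul, mul_pow]
    linear_combination h
  have h0 : A 0 0 * w 0 + A 0 1 * w 1 = lam * w 0 := by
    simpa [mulVec, dotProduct, Fin.sum_univ_two] using congrFun hAw 0
  have h1 : A 1 0 * w 0 + A 1 1 * w 1 = lam * w 1 := by
    simpa [mulVec, dotProduct, Fin.sum_univ_two] using congrFun hAw 1
  refine ⟨!![w 0, -w 1 ^ q; w 1, w 0 ^ q], ?_, ?_⟩
  · ext i j
    fin_cases i <;> fin_cases j <;>
      simp [ctrans, mul_apply, Fin.sum_univ_two, hqodd.neg_pow, hconj]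
    · exact hww
    · ring
    · ring
    · linear_combination hww
  · simp only [Matrix.mul_assoc]
    simp [ctrans, mul_apply, Fin.sum_univ_two, hqodd.neg_pow, hconj]
    linear_combination w 0 * h1 - w 1 * h0
end

section
/- Let q be an odd prime power, F the finite field with q² elements, A a 2×2 matrix over F, and r, s ∈ 𝔽_q. Suppose F_A(1, 0, −r) = 0 and there is a nonzero c ∈ F with ∇F_A(1, 0, −r) = c·(r, s, 1) (i.e., r + β·s lies on the boundary generating curve with vertical tangent line x = r, and F_A is nonsingular at (1 : 0 : −r)). Then r + β·s ∈ W(A). -/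
open Matrix MvPolynomial

/-- In a finite field of order `q ^ 2`, every nonzero element fixed by `x ↦ x ^ q` is a norm. -/
theorem exists_pow_mul_self_eq {F : Type*} [Field F] [Fintype F] {q : ℕ} (hq : 1 < q)
    (hcard : Fintype.card F = q ^ 2) {x : F} (hx0 : x ≠ 0) (hx : x ^ q = x) :
    ∃ l : F, l ^ q * l = x := by
  classical
  obtain ⟨g, hg⟩ := IsCyclic.exists_generator (α := Fˣ)
  obtain ⟨m, hm⟩ := (mem_powers_iff_mem_zpowers (x := g)).2 (hg (Units.mk0 x hx0))
  obtain ⟨k, rfl⟩ : ∃ k, q = k + 1 := ⟨q - 1, by omega⟩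
  have hpow : g ^ (m * k) = 1 := by
    have hm' : g ^ m = Units.mk0 x hx0 := hm
    rw [pow_mul, hm']
    ext
    exact mul_right_cancel₀ hx0 (by simpa [pow_succ] using hx)
  have hdvd := orderOf_dvd_of_pow_eq_one hpow
  have hcard' : Fintype.card F - 1 = (k + 2) * k := by
    rw [hcard, Nat.sub_eq_iff_eq_add (Nat.one_le_pow _ _ (by omega))]
    ring
  rw [orderOf_eq_card_of_forall_mem_zpowers hg, Nat.card_eq_fintype_card, Fintype.card_units,
    hcard'] at hdvd
  obtain ⟨j, rfl⟩ := Nat.dvd_of_mul_dvd_mul_right (by omega) hdvd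
  refine ⟨((g ^ j : Fˣ) : F), ?_⟩
  have hval : ((g ^ ((k + 2) * j) : Fˣ) : F) = x := by
    simpa using congrArg Units.val hm
  rw [← hval]
  push_cast
  ring

/-- If `q` is a positive power of a prime and `F` has `q ^ 2` elements, then `x ↦ x ^ q` is
additive. -/
theorem add_pow_of_card_eq_sq {F : Type*} [Field F] [Fintype F] {q : ℕ}
    (hq : ∃ p k : ℕ, p.Prime ∧ Odd p ∧ 0 < k ∧ q = p ^ k)
    (hcard : Fintype.card F = q ^ 2) (x y : F) : (x + y) ^ q = x ^ q + y ^ q := by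
  obtain ⟨p, k, hp, -, -, rfl⟩ := hq
  have : Fact p.Prime := ⟨hp⟩
  have : CharP F p := charP_of_card_eq_prime_pow (f := k * 2)
    (by rw [hcard, pow_mul])
  exact add_pow_char_pow x y p k

theorem two_ne_zero_of_card_eq_sq {F : Type*} [Field F] [Fintype F] {q : ℕ}
    (hq : ∃ p k : ℕ, p.Prime ∧ Odd p ∧ 0 < k ∧ q = p ^ k)
    (hcard : Fintype.card F = q ^ 2) : (2 : F) ≠ 0 := by
  obtain ⟨p, k, hp, hodd, -, rfl⟩ := hq
  refine Ring.two_ne_zero fun h => ?_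
  have := FiniteField.even_card_iff_char_two.1 h
  rw [hcard] at this
  exact Nat.not_even_iff_odd.2 (hodd.pow.pow) (Nat.even_iff.2 this)

/-- `H₁` is Hermitian. -/
theorem Hone_pow {F : Type*} [Field F] {q n : ℕ}
    (hadd : ∀ x y : F, (x + y) ^ q = x ^ q + y ^ q) (hinv : ∀ x : F, (x ^ q) ^ q = x)
    (A : Matrix (Fin n) (Fin n) F) (i j : Fin n) : Hone q A i j ^ q = Hone q A j i := by
  have h2 : (2 : F) ^ q = 2 := by rw [← one_add_one_eq_two, hadd, one_pow]
  simp only [Hone, ctrans, Matrix.smul_apply, Matrix.add_apply, Matrix.of_apply, smul_eq_mul,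
    mul_pow, inv_pow, h2, hadd, hinv]
  ring

/-- The Cartesian decomposition `A = H₁ + β H₂`. -/
theorem eq_Hone_add_Htwo {F : Type*} [Field F] {q n : ℕ} {β : F} (h2 : (2 : F) ≠ 0)
    (hβ0 : β ≠ 0) (A : Matrix (Fin n) (Fin n) F) (i j : Fin n) :
    A i j = Hone q A i j + β * Htwo q β A i j := by
  simp only [Hone, Htwo, Matrix.smul_apply, Matrix.add_apply, Matrix.sub_apply, smul_eq_mul]
  field_simp
  ring

theorem stmt_11 {F : Type*} [Field F] [Fintype F] (q : ℕ)
    (hq : ∃ p k : ℕ, p.Prime ∧ Odd p ∧ 0 < k ∧ q = p ^ k)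
    (hcard : Fintype.card F = q ^ 2)
    (β : F) (hβ0 : β ≠ 0) (hβ : β ^ q = -β)
    (A : Matrix (Fin 2) (Fin 2) F) (r s : F) (hr : r ^ q = r) (hs : s ^ q = s)
    (h0 : eval ![1, 0, -r] (basePoly q β A) = 0)
    (hgrad : ∃ c : F, c ≠ 0 ∧ gradBP q β A ![1, 0, -r] = c • ![r, s, 1]) :
    r + β * s ∈ numRange q A := by
  have hq1 : 1 < q := by
    obtain ⟨p, k, hp, -, hk, rfl⟩ := hq
    exact Nat.one_lt_pow hk.ne' hp.one_lt
  have hadd := add_pow_of_card_eq_sq hq hcard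
  have h2 := two_ne_zero_of_card_eq_sq hq hcard
  have hinv : ∀ x : F, (x ^ q) ^ q = x := fun x => by
    rw [← pow_mul, ← sq, ← hcard, FiniteField.pow_card]
  have hneg : ∀ x : F, (-x) ^ q = -x ^ q := fun x =>
    eq_neg_of_add_eq_zero_left (by rw [← hadd, neg_add_cancel, zero_pow (by omega)])
  have hA := eq_Hone_add_Htwo (q := q) h2 hβ0 A
  have h00 := Hone_pow hadd hinv A 0 0
  have h01 := Hone_pow hadd hinv A 0 1
  have h10 := Hone_pow hadd hinv A 1 0
  have h11 := Hone_pow hadd hinv A 1 1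
  obtain ⟨c, hc0, hc⟩ := hgrad
  have hc1 := congrFun hc 1
  have hc2 := congrFun hc 2
  simp only [gradBP, basePoly, Matrix.det_fin_two] at h0 hc1 hc2
  simp [pderiv_X, Derivation.leibniz] at h0 hc1 hc2
  simp only [numRange, herm, Set.mem_ofPred_eq, Fin.sum_univ_two, Matrix.mulVec, dotProduct, hA]
  generalize Hone q A = H at *
  generalize Htwo q β A = K at *
  by_cases hd : H 1 1 - r = 0
  · have hoff : H 0 1 = 0 ∧ H 1 0 = 0 := by
      have hmul : H 0 1 * H 1 0 = 0 := by
        linear_combination (H 0 0 - r) * hd - h0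
      rcases mul_eq_zero.1 hmul with h | h
      · exact ⟨h, by rw [← h01, h, zero_pow (by omega)]⟩
      · exact ⟨by rw [← h10, h, zero_pow (by omega)], h⟩
    have hK : K 1 1 = s := mul_left_cancel₀ hc0 <| by
      rw [hoff.1, hoff.2] at hc1
      linear_combination hc1 - K 1 1 * hc2 + (K 1 1 - K 0 0) * hd
    refine ⟨![0, 1], ?_, ?_⟩
    · simp [zero_pow (show q ≠ 0 by omega)]
    · simp [zero_pow (show q ≠ 0 by omega), hK]
      linear_combination hd
  · have hfix : ((H 1 1 - r) * c)⁻¹ ^ q = ((H 1 1 - r) * c)⁻¹ := by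
      rw [← hc2]
      simp only [inv_pow, mul_pow, hadd, hneg, sub_eq_add_neg, h00, h11, hr]
    obtain ⟨l, hl⟩ := exists_pow_mul_self_eq hq1 hcard (inv_ne_zero (mul_ne_zero hd hc0)) hfix
    have hl1 : l ^ q * l * ((H 1 1 - r) * c) = 1 := by
      rw [hl, inv_mul_cancel₀ (mul_ne_zero hd hc0)]
    have hx : (l * (H 1 1 - r)) ^ q = l ^ q * (H 1 1 - r) := by
      rw [mul_pow, sub_eq_add_neg, hadd, hneg, h11, hr]
    have hy : (-(l * H 1 0)) ^ q = -(l ^ q * H 0 1) := by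
      rw [hneg, mul_pow, h10]
    have hnorm : l ^ q * (H 1 1 - r) * (l * (H 1 1 - r)) + l ^ q * H 0 1 * (l * H 1 0) = 1 := by
      linear_combination hl1 - l ^ q * l * h0 + l ^ q * l * (H 1 1 - r) * hc2
    refine ⟨![l * (H 1 1 - r), -(l * H 1 0)], ?_, ?_⟩
    · simp only [Matrix.cons_val_zero, Matrix.cons_val_one, hx, hy]
      linear_combination hnorm
    · simp only [Matrix.cons_val_zero, Matrix.cons_val_one, hx, hy]
      linear_combination r * hnorm + l ^ q * l * (H 1 1 - r) * h0
        + β * (l ^ q * l) * (H 1 1 - r) * hc1 - β * (l ^ q * l) * K 1 1 * h0 + β * s * hl1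
end
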